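/- arXiv:1607.00956 — 2 statements merged into one kernel-verified Lean document; each statement's English description precedes it below -/
import Mathlib

section
/- Let Δ be a convex set of probability distributions on X and suppose q0 ∈ Δ minimizes the dissipation functional W_d over Δ and lies in the relative interior of Δ, in the sense that for every r0 ∈ Δ there exists t > 0 with q0 + t(q0 − r0) ∈ Δ. Then for every r0 ∈ Δ, W_d(r0) − W_d(q0) = D(r0‖q0) − D(r0P‖q0P). -/
open Finset

/-- `p` is a probability distribution on the finite set `X`. -/
def IsProb {X : Type*} [Fintype X] (p : X → ℝ) : Prop :=
  (∀ x, 0 ≤ p x) ∧ ∑ x, p x = 1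

/-- `P` is a row-stochastic kernel on `X`; `P x0 x1` denotes `P(x1|x0)`. -/
def IsKernel {X : Type*} [Fintype X] (P : X → X → ℝ) : Prop :=
  (∀ x0 x1, 0 ≤ P x0 x1) ∧ ∀ x0, ∑ x1, P x0 x1 = 1

/-- Push-forward of `p` under the kernel `P`: `(pP)(x1) = Σ_{x0} p(x0) P(x1|x0)`. -/
def push {X : Type*} [Fintype X] (P : X → X → ℝ) (p : X → ℝ) : X → ℝ :=
  fun x1 => ∑ x0, p x0 * P x0 x1

/-- Shannon entropy with natural logarithm (`Real.log 0 = 0` gives the `0 ln 0 = 0` convention). -/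
noncomputable def shannon {X : Type*} [Fintype X] (p : X → ℝ) : ℝ :=
  -∑ x, p x * Real.log (p x)

/-- Dissipation functional `W_d(p) = S(pP) − S(p) − Σ_x p(x) Q(x)`. -/
noncomputable def Wd {X : Type*} [Fintype X] (P : X → X → ℝ) (Q : X → ℝ) (p : X → ℝ) : ℝ :=
  shannon (push P p) - shannon p - ∑ x, p x * Q x

/-- Kullback–Leibler divergence `D(r‖q) = Σ_x r(x) ln(r(x)/q(x))`
(terms with `r x = 0` vanish since `0 * log _ = 0`). -/
noncomputable def KL {X : Type*} [Fintype X] (r q : X → ℝ) : ℝ :=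
  ∑ x, r x * Real.log (r x / q x)

/-- The push-forward is affine along the line through `q` and `r`. -/
lemma push_add_smul_sub {X : Type*} [Fintype X] (P : X → X → ℝ) (q r : X → ℝ) (s : ℝ) :
    push P (q + s • (r - q)) = push P q + s • (push P r - push P q) := by
  funext y
  simp only [push, Pi.add_apply, Pi.smul_apply, Pi.sub_apply, smul_eq_mul]
  rw [← Finset.sum_sub_distrib, Finset.mul_sum, ← Finset.sum_add_distrib]
  exact Finset.sum_congr rfl fun x _ => by ring

/-- The push-forward under a row-stochastic kernel preserves total mass. -/
lemma sum_push {X : Type*} [Fintype X] {P : X → X → ℝ} (hP : IsKernel P) (p : X → ℝ) :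
    ∑ y, push P p y = ∑ x, p x := by
  simp only [push]
  rw [Finset.sum_comm]
  simp only [← Finset.mul_sum, hP.2, mul_one]

/-- The push-forward of a nonnegative function is nonnegative. -/
lemma push_nonneg {X : Type*} [Fintype X] {P : X → X → ℝ} (hP : IsKernel P) {p : X → ℝ}
    (hp : ∀ x, 0 ≤ p x) (y : X) : 0 ≤ push P p y :=
  Finset.sum_nonneg fun x _ => mul_nonneg (hp x) (hP.1 x y)

/-- If `r ≥ 0` and the line from `r` through `q` can be continued past `q` within the nonnegative
functions, then `r` vanishes where `q` does. -/
lemma eq_zero_of_extension_nonneg {X : Type*} {q r : X → ℝ} {t : ℝ} (ht : 0 < t)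
    (hr : ∀ x, 0 ≤ r x) (h : ∀ x, 0 ≤ (q + (-t) • (r - q)) x) (x : X) (hq : q x = 0) :
    r x = 0 := by
  have hx := h x
  simp only [Pi.add_apply, Pi.smul_apply, Pi.sub_apply, smul_eq_mul, hq] at hx
  nlinarith [hr x]

/-- Directional derivative of the entropy at `q` in a direction supported on the support of `q`. -/
lemma hasDerivAt_shannon_line {X : Type*} [Fintype X] (q d : X → ℝ)
    (h : ∀ x, q x = 0 → d x = 0) :
    HasDerivAt (fun s : ℝ => shannon (q + s • d)) (-∑ x, (Real.log (q x) + 1) * d x) 0 := by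
  unfold shannon
  refine (HasDerivAt.fun_sum fun x _ => ?_).neg
  by_cases hq : q x = 0
  · simpa [hq, h x hq] using hasDerivAt_const (0 : ℝ) (0 : ℝ)
  · have h1 : HasDerivAt (fun s : ℝ => (q + s • d) x) (d x) 0 := by
      simpa using ((hasDerivAt_id (0 : ℝ)).mul_const (d x)).const_add (q x)
    have h2 : HasDerivAt (fun y : ℝ => y * Real.log y) (Real.log (q x) + 1)
        ((q + (0 : ℝ) • d) x) := by
      simpa using Real.hasDerivAt_mul_log hq
    exact h2.comp (0 : ℝ) h1

/-- Relative entropy as cross entropy minus entropy. -/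
lemma KL_eq_neg_shannon_sub {X : Type*} [Fintype X] (r q : X → ℝ)
    (h : ∀ x, q x = 0 → r x = 0) :
    KL r q = -shannon r - ∑ x, r x * Real.log (q x) := by
  rw [KL, shannon, neg_neg, ← Finset.sum_sub_distrib]
  refine Finset.sum_congr rfl fun x _ => ?_
  by_cases hr : r x = 0
  · simp [hr]
  · rw [Real.log_div hr fun hq => hr (h x hq), mul_sub]

/-- Directional derivative of the dissipation functional at `q` towards `r`. -/
lemma hasDerivAt_Wd_line {X : Type*} [Fintype X] (P : X → X → ℝ) (Q q r : X → ℝ)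
    (h : ∀ x, q x = 0 → r x = 0) (hpush : ∀ y, push P q y = 0 → push P r y = 0) :
    HasDerivAt (fun s : ℝ => Wd P Q (q + s • (r - q)))
      (-∑ y, (Real.log (push P q y) + 1) * (push P r - push P q) y
        - -∑ x, (Real.log (q x) + 1) * (r - q) x - ∑ x, (r - q) x * Q x) 0 := by
  unfold Wd
  simp only [push_add_smul_sub]
  refine ((hasDerivAt_shannon_line _ _ fun y hy => ?_).sub
    (hasDerivAt_shannon_line _ _ fun x hx => ?_)).sub (HasDerivAt.fun_sum fun x _ => ?_)
  · simp [hy, hpush y hy]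
  · simp [hx, h x hx]
  · simpa using
      (((hasDerivAt_id (0 : ℝ)).mul_const ((r - q) x)).const_add (q x)).mul_const (Q x)

/-- If `q0` minimizes dissipation over a convex set `Δ` of probability
distributions and lies in the relative interior of `Δ` (in the sense that one can move
slightly past `q0` away from any `r0 ∈ Δ` while staying in `Δ`), then for every `r0 ∈ Δ`,
`W_d(r0) − W_d(q0) = D(r0‖q0) − D(r0P‖q0P)`. -/
theorem incorrect_prior_dissipation_relative_interior {X : Type*} [Fintype X] [Nonempty X]
    (P : X → X → ℝ) (Q : X → ℝ) (hP : IsKernel P)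
    (Δ : Set (X → ℝ)) (hΔprob : ∀ p ∈ Δ, IsProb p) (hΔconv : Convex ℝ Δ)
    (q0 : X → ℝ) (hq0 : q0 ∈ Δ)
    (hmin : ∀ p ∈ Δ, Wd P Q q0 ≤ Wd P Q p)
    (hrelint : ∀ r0 ∈ Δ, ∃ t : ℝ, 0 < t ∧ q0 + t • (q0 - r0) ∈ Δ)
    (r0 : X → ℝ) (hr0 : r0 ∈ Δ) :
    Wd P Q r0 - Wd P Q q0 = KL r0 q0 - KL (push P r0) (push P q0) := by
  obtain ⟨t, ht, hmem⟩ := hrelint r0 hr0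
  replace hmem : q0 + (-t) • (r0 - q0) ∈ Δ := by
    rwa [neg_smul, ← smul_neg, neg_sub]
  have hsupp := eq_zero_of_extension_nonneg ht (hΔprob r0 hr0).1 (hΔprob _ hmem).1
  have hsupp' : ∀ y, push P q0 y = 0 → push P r0 y = 0 := by
    refine eq_zero_of_extension_nonneg ht (push_nonneg hP (hΔprob r0 hr0).1) ?_
    rw [← push_add_smul_sub]
    exact push_nonneg hP (hΔprob _ hmem).1
  have hline : ∀ s ∈ Set.Ioo (-t) 1, q0 + s • (r0 - q0) ∈ Δ := by
    intro s hs
    have ht1 : (0 : ℝ) < 1 + t := by linarith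
    have key := hΔconv hmem hr0 (a := (1 - s) / (1 + t)) (b := (s + t) / (1 + t))
      (div_nonneg (by linarith [hs.2]) ht1.le) (div_nonneg (by linarith [hs.1]) ht1.le)
      (by field_simp; ring)
    convert key using 1
    funext x
    simp only [Pi.add_apply, Pi.smul_apply, Pi.sub_apply, smul_eq_mul]
    field_simp
    ring
  have hloc : IsLocalMin (fun s : ℝ => Wd P Q (q0 + s • (r0 - q0))) 0 := by
    filter_upwards [Ioo_mem_nhds (neg_lt_zero.2 ht) zero_lt_one] with s hs
    simpa using hmin _ (hline s hs)
  have hzero := hloc.hasDerivAt_eq_zero (hasDerivAt_Wd_line P Q q0 r0 hsupp hsupp')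
  have hsum : ∑ x, r0 x = ∑ x, q0 x := (hΔprob r0 hr0).2.trans (hΔprob q0 hq0).2.symm
  have hsum' : ∑ y, push P r0 y = ∑ y, push P q0 y := by
    rw [sum_push hP, sum_push hP, hsum]
  rw [KL_eq_neg_shannon_sub _ _ hsupp, KL_eq_neg_shannon_sub _ _ hsupp']
  simp only [Pi.sub_apply, add_mul, mul_sub, sub_mul, one_mul, Finset.sum_add_distrib,
    Finset.sum_sub_distrib, mul_comm (Real.log _)] at hzero
  simp only [Wd, shannon]
  linarith
end

section
/- Assume the computationally cyclic condition: for all v0, v1 ∈ V and all x1 ∈ X, Σ_{x0} [g(x1) = v1] P(x1|x0) s(x0|v0) = s(x1|v1) π(v1|v0), where π(v1|v0) = Σ_{x1' : g(x1') = v1} Σ_{x0} P(x1'|x0) s(x0|v0) is the induced macrostate kernel. Suppose q^V is a probability distribution on V with full support that minimizes p^V ↦ W_d(Φ(p^V)) over all probability distributions on V. Then for every probability distribution r^V on V, W_d(Φ(r^V)) − W_d(Φ(q^V)) = D(r^V‖q^V) − D(r^Vπ‖q^Vπ), where (p^Vπ)(v1) = Σ_{v0} p^V(v0) π(v1|v0).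 -/
open Finset

section Divergence

variable {X : Type*} [Fintype X]

theorem KL_nonneg {r q : X → ℝ} (hr : IsProb r) (hq : IsProb q) (hac : ∀ x, q x = 0 → r x = 0) :
    0 ≤ KL r q := by
  have hterm : ∀ x, r x - q x ≤ r x * Real.log (r x / q x) := by
    intro x
    rcases (hr.1 x).eq_or_lt with h | h
    · simp [← h, hq.1 x]
    · have hqx : 0 < q x := (hq.1 x).lt_of_ne fun h0 => h.ne' (hac x h0.symm)
      have hlog := Real.one_sub_inv_le_log_of_pos (div_pos h hqx)
      calc r x - q x = r x * (1 - (r x / q x)⁻¹) := by field_simp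
        _ ≤ _ := mul_le_mul_of_nonneg_left hlog h.le
  have hsum := Finset.sum_le_sum fun x (_ : x ∈ Finset.univ) => hterm x
  rw [Finset.sum_sub_distrib, hr.2, hq.2, sub_self] at hsum
  exact hsum

theorem KL_le_chiSq {p q : X → ℝ} (hp : IsProb p) (hq : IsProb q) (hpos : ∀ x, 0 < q x) :
    KL p q ≤ ∑ x, (p x - q x) ^ 2 / q x := by
  have hterm : ∀ x, p x * Real.log (p x / q x) ≤ (p x - q x) ^ 2 / q x + (p x - q x) := by
    intro x
    have hqx := hpos x
    rcases (hp.1 x).eq_or_lt with h | h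
    · rw [← h]
      field_simp
      simp
    · calc p x * Real.log (p x / q x) ≤ p x * (p x / q x - 1) :=
            mul_le_mul_of_nonneg_left (Real.log_le_sub_one_of_pos (div_pos h hqx)) h.le
        _ = _ := by field_simp; ring
  have hsum := Finset.sum_le_sum fun x (_ : x ∈ Finset.univ) => hterm x
  rw [Finset.sum_add_distrib, Finset.sum_sub_distrib, hp.2, hq.2, sub_self, add_zero] at hsum
  exact hsum

theorem KL_self {q : X → ℝ} : KL q q = 0 := by
  refine Finset.sum_eq_zero fun x _ => ?_
  by_cases h : q x = 0 <;> simp [h]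

theorem shannon_add_KL {r q : X → ℝ} (hac : ∀ x, q x = 0 → r x = 0) :
    shannon r + KL r q = -∑ x, r x * Real.log (q x) := by
  rw [shannon, KL, ← Finset.sum_neg_distrib, ← Finset.sum_neg_distrib, ← Finset.sum_add_distrib]
  refine Finset.sum_congr rfl fun x _ => ?_
  by_cases h : r x = 0
  · simp [h]
  · rw [Real.log_div h fun h0 => h (hac x h0)]
    ring

end Divergence

section Kernel

variable {X : Type*} [Fintype X] {P : X → X → ℝ}

theorem sum_push_mul (P : X → X → ℝ) (p f : X → ℝ) :
    ∑ x, push P p x * f x = ∑ x, p x * ∑ y, P x y * f y := by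
  simp only [push, Finset.sum_mul, Finset.mul_sum]
  rw [Finset.sum_comm]
  simp only [mul_assoc]

theorem IsProb.push {p : X → ℝ} (hp : IsProb p) (hP : IsKernel P) : IsProb (push P p) := by
  refine ⟨fun x => Finset.sum_nonneg fun y _ => mul_nonneg (hp.1 y) (hP.1 y x), ?_⟩
  simpa [hP.2, hp.2] using sum_push_mul P p fun _ => 1

theorem push_eq_zero_of_push_eq_zero (hP : IsKernel P) {q : X → ℝ} (hpos : ∀ x, 0 < q x)
    (r : X → ℝ) {x : X} (h : push P q x = 0) : push P r x = 0 := by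
  have hz := (Finset.sum_eq_zero_iff_of_nonneg
    fun y _ => mul_nonneg (hpos y).le (hP.1 y x)).1 h
  refine Finset.sum_eq_zero fun y hy => ?_
  rw [(mul_eq_zero.1 (hz y hy)).resolve_left (hpos y).ne', mul_zero]

theorem Wd_eq_sum_add_KL_sub_KL (hP : IsKernel P) (Q : X → ℝ) {q : X → ℝ} (hpos : ∀ x, 0 < q x)
    (p : X → ℝ) :
    Wd P Q p = ∑ x, p x * (Real.log (q x) - (∑ y, P x y * Real.log (push P q y)) - Q x)
      + KL p q - KL (push P p) (push P q) := by
  have hin := shannon_add_KL (r := p) fun x h => absurd h (hpos x).ne'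
  have hout := shannon_add_KL fun x => push_eq_zero_of_push_eq_zero hP hpos p (x := x)
  rw [sum_push_mul P p fun y => Real.log (push P q y)] at hout
  simp only [Wd, mul_sub, Finset.sum_sub_distrib]
  linarith

theorem eq_zero_of_linear_add_sq_nonneg {L C ε : ℝ} (hε : 0 < ε)
    (h : ∀ t, |t| < ε → 0 ≤ t * L + t ^ 2 * C) : L = 0 := by
  have hmin : IsLocalMin (fun t : ℝ => t * L + t ^ 2 * C) 0 := by
    filter_upwards [Metric.ball_mem_nhds (0 : ℝ) hε] with t ht
    simpa using h t (by simpa using ht)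
  have hderiv : HasDerivAt (fun t : ℝ => t * L + t ^ 2 * C) L 0 := by
    refine (((hasDerivAt_id (0 : ℝ)).mul_const L).add
      (((hasDerivAt_id (0 : ℝ)).pow 2).mul_const C)).congr_deriv ?_
    simp
  exact hmin.hasDerivAt_eq_zero hderiv

theorem exists_pos_le_of_forall_pos {q : X → ℝ} (hpos : ∀ x, 0 < q x) :
    ∃ ε > 0, ∀ x, ε ≤ q x := by
  rcases isEmpty_or_nonempty X with hX | hX
  · exact ⟨1, one_pos, fun x => hX.elim x⟩
  · obtain ⟨x₀, h₀⟩ := Finite.exists_min q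
    exact ⟨q x₀, hpos x₀, h₀⟩

theorem IsProb.le_one {p : X → ℝ} (hp : IsProb p) (x : X) : p x ≤ 1 :=
  hp.2 ▸ Finset.single_le_sum (fun y _ => hp.1 y) (Finset.mem_univ x)

/-- Dissipation formula for an incorrect prior at the level of distributions on `X` itself. -/
theorem Wd_sub_Wd_eq_KL_sub_KL (hP : IsKernel P) (Q : X → ℝ) {q r : X → ℝ} (hq : IsProb q)
    (hpos : ∀ x, 0 < q x) (hmin : ∀ p, IsProb p → Wd P Q q ≤ Wd P Q p) (hr : IsProb r) :
    Wd P Q r - Wd P Q q = KL r q - KL (push P r) (push P q) := by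
  set a : X → ℝ := fun x => Real.log (q x) - (∑ y, P x y * Real.log (push P q y)) - Q x
  have hW : ∀ p, Wd P Q p = ∑ x, p x * a x + KL p q - KL (push P p) (push P q) :=
    Wd_eq_sum_add_KL_sub_KL hP Q hpos
  obtain ⟨ε, hε, hεq⟩ := exists_pos_le_of_forall_pos hpos
  have hL : ∑ x, (r x - q x) * a x = 0 := by
    refine eq_zero_of_linear_add_sq_nonneg (C := ∑ x, (r x - q x) ^ 2 / q x) hε fun t ht => ?_
    set p : X → ℝ := fun x => q x + t * (r x - q x) with hp_def
    have hp : IsProb p := by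
      refine ⟨fun x => ?_, ?_⟩
      · have hd : |r x - q x| ≤ 1 := abs_le.2
          ⟨by linarith [hr.1 x, hq.le_one x], by linarith [hq.1 x, hr.le_one x]⟩
        have hle : |t * (r x - q x)| ≤ ε := by
          rw [abs_mul]
          nlinarith [abs_nonneg t, abs_nonneg (r x - q x)]
        simp only [hp_def]
        linarith [hεq x, (abs_le.1 hle).1]
      · simp [hp_def, Finset.sum_add_distrib, ← Finset.mul_sum, hq.2, hr.2]
    have hle := hmin p hp
    rw [hW q, hW p, KL_self, KL_self] at hle
    have hout := KL_nonneg (hp.push hP) (hq.push hP)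
      fun x => push_eq_zero_of_push_eq_zero hP hpos p
    have hin := KL_le_chiSq hp hq hpos
    have hchi : ∑ x, (p x - q x) ^ 2 / q x = t ^ 2 * ∑ x, (r x - q x) ^ 2 / q x := by
      rw [Finset.mul_sum]
      refine Finset.sum_congr rfl fun x _ => ?_
      simp only [hp_def]
      ring
    have hlin : ∑ x, p x * a x = ∑ x, q x * a x + t * ∑ x, (r x - q x) * a x := by
      rw [Finset.mul_sum, ← Finset.sum_add_distrib]
      refine Finset.sum_congr rfl fun x _ => ?_
      simp only [hp_def]
      ring
    linarith
  simp only [sub_mul, Finset.sum_sub_distrib] at hL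
  rw [hW r, hW q, KL_self, KL_self]
  linarith

end Kernel

section CoarseGraining

variable {X V : Type*} [Fintype X] [Fintype V] {g : X → V} {s : V → X → ℝ}

theorem sum_induced_mul (hs0 : ∀ v x, g x ≠ v → s v x = 0) (p : V → ℝ) (f : X → ℝ) :
    ∑ x, p (g x) * s (g x) x * f x = ∑ v, p v * ∑ x, s v x * f x := by
  simp only [Finset.mul_sum]
  rw [Finset.sum_comm]
  refine Finset.sum_congr rfl fun x _ => ?_
  rw [Finset.sum_eq_single_of_mem (g x) (Finset.mem_univ _)
    fun v _ hv => by rw [hs0 v x hv.symm]; ring]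
  ring

theorem shannon_induced (hs : ∀ v, IsProb (s v)) (hs0 : ∀ v x, g x ≠ v → s v x = 0)
    (p : V → ℝ) :
    shannon (fun x => p (g x) * s (g x) x) = shannon p + ∑ v, p v * shannon (s v) := by
  have hlog : ∑ x, p (g x) * s (g x) x * Real.log (p (g x) * s (g x) x) =
      ∑ v, p v * ∑ x, s v x * (Real.log (p v) + Real.log (s v x)) := by
    rw [sum_induced_mul hs0 p fun x => Real.log (p (g x) * s (g x) x)]
    refine Finset.sum_congr rfl fun v _ => ?_
    simp only [Finset.mul_sum]
    refine Finset.sum_congr rfl fun x _ => ?_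
    by_cases hp : p v = 0
    · simp [hp]
    by_cases hsx : s v x = 0
    · simp [hsx]
    have hgx : g x = v := by
      by_contra h
      exact hsx (hs0 v x h)
    rw [hgx, Real.log_mul hp hsx]
  simp only [shannon]
  rw [hlog]
  simp only [mul_add, mul_neg, Finset.sum_add_distrib, ← Finset.sum_mul, (hs _).2, one_mul,
    Finset.sum_neg_distrib]
  ring

theorem Wd_induced {P : X → X → ℝ} {π : V → V → ℝ} (hs : ∀ v, IsProb (s v))
    (hs0 : ∀ v x, g x ≠ v → s v x = 0)
    (hcyc : ∀ v x, ∑ y, s v y * P y x = s (g x) x * π v (g x)) (Q : X → ℝ) (p : V → ℝ) :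
    Wd P Q (fun x => p (g x) * s (g x) x) =
      Wd π (fun v => shannon (s v) - (∑ w, π v w * shannon (s w)) + ∑ x, s v x * Q x) p := by
  have hpush : push P (fun x => p (g x) * s (g x) x) =
      fun x => push π p (g x) * s (g x) x := by
    funext x
    simp only [push]
    rw [sum_induced_mul hs0 p fun y => P y x, Finset.sum_mul]
    refine Finset.sum_congr rfl fun v _ => ?_
    rw [hcyc]
    ring
  simp only [Wd]
  rw [hpush, shannon_induced hs hs0, shannon_induced hs hs0, sum_induced_mul hs0,
    sum_push_mul π p fun w => shannon (s w)]
  simp only [mul_add, mul_sub, Finset.sum_add_distrib, Finset.sum_sub_distrib]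
  ring

theorem isKernel_induced [DecidableEq V] {P : X → X → ℝ} (hP : IsKernel P) {π : V → V → ℝ}
    (hs : ∀ v, IsProb (s v))
    (hπ : ∀ v w, π v w = ∑ x ∈ Finset.univ.filter (fun x => g x = w), ∑ y, P y x * s v y) :
    IsKernel π := by
  refine ⟨fun v w => ?_, fun v => ?_⟩
  · rw [hπ]
    exact Finset.sum_nonneg fun x _ => Finset.sum_nonneg fun y _ =>
      mul_nonneg (hP.1 y x) ((hs v).1 y)
  · simp only [hπ]
    rw [Finset.sum_fiberwise, Finset.sum_comm]
    simp only [← Finset.sum_mul, hP.2, one_mul, (hs v).2]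

end CoarseGraining

/-- Coarse-grained main result. Under the computationally cyclic condition,
if `q^V` is a full-support minimizer of `p^V ↦ W_d(Φ(p^V))` over input distributions,
then for every input distribution `r^V`,
`W_d(Φ(r^V)) − W_d(Φ(q^V)) = D(r^V‖q^V) − D(r^Vπ‖q^Vπ)`. -/
theorem coarse_grained_incorrect_prior_dissipation {X V : Type*} [Fintype X] [Nonempty X]
    [Fintype V] [Nonempty V] [DecidableEq V]
    (P : X → X → ℝ) (Q : X → ℝ) (hP : IsKernel P)
    (g : X → V) (hg : Function.Surjective g)
    (s : V → X → ℝ) (hs : ∀ v, IsProb (s v)) (hs0 : ∀ v x, g x ≠ v → s v x = 0)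
    (π : V → V → ℝ)
    (hπ : ∀ v0 v1, π v0 v1 =
      ∑ x1 ∈ Finset.univ.filter (fun x1 => g x1 = v1), ∑ x0, P x0 x1 * s v0 x0)
    (hcyclic : ∀ v0 v1 x1,
      (if g x1 = v1 then (1 : ℝ) else 0) * ∑ x0, P x0 x1 * s v0 x0 = s v1 x1 * π v0 v1)
    (qV : V → ℝ) (hq : IsProb qV) (hqfull : ∀ v, 0 < qV v)
    (hmin : ∀ pV : V → ℝ, IsProb pV →
      Wd P Q (fun x => qV (g x) * s (g x) x) ≤ Wd P Q (fun x => pV (g x) * s (g x) x))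
    (rV : V → ℝ) (hr : IsProb rV) :
    Wd P Q (fun x => rV (g x) * s (g x) x) - Wd P Q (fun x => qV (g x) * s (g x) x)
      = KL rV qV -
        KL (fun v1 => ∑ v0, rV v0 * π v0 v1) (fun v1 => ∑ v0, qV v0 * π v0 v1) := by
  have hcyc : ∀ v x, ∑ y, s v y * P y x = s (g x) x * π v (g x) := by
    intro v x
    simpa [mul_comm] using hcyclic v (g x) x
  simp only [Wd_induced hs hs0 hcyc Q] at hmin ⊢
  exact Wd_sub_Wd_eq_KL_sub_KL (isKernel_induced hP hs hπ) _ hq hqfull hmin hr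
end
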